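/- Define R^{reg}(γ,λ) = lim_{z→γ} (z−γ) R(z,λ), the residue of the elliptic dynamical R-matrix at its simple pole z = γ. There is a dense open subset U ⊆ ℂ × ℂ^N such that for all (γ,λ) ∈ U, the kernel of R^{reg}(γ,λ) equals S²(ℂ^N), the space of symmetric tensors in ℂ^N ⊗ ℂ^N. -/

import Mathlib

open scoped BigOperators
open Complex Matrix Filter Topology

noncomputable section

namespace EllipticQG

/-- Jacobi's first theta function `θ(z) = -∑_{j ∈ ℤ+1/2} e^{πij²τ + 2πij(z+1/2)}`. -/
def theta (τ z : ℂ) : ℂ :=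
  -∑' j : ℤ, Complex.exp ((Real.pi : ℂ) * Complex.I * ((j : ℂ) + 1 / 2) ^ 2 * τ +
      2 * (Real.pi : ℂ) * Complex.I * ((j : ℂ) + 1 / 2) * (z + 1 / 2))

/-- `α(z,μ) = θ(z)θ(μ+γ)/(θ(z-γ)θ(μ))`. -/
def alphaF (τ γ z μ : ℂ) : ℂ :=
  theta τ z * theta τ (μ + γ) / (theta τ (z - γ) * theta τ μ)

/-- `β(z,μ) = -θ(z+μ)θ(γ)/(θ(z-γ)θ(μ))`. -/
def betaF (τ γ z μ : ℂ) : ℂ :=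
  -(theta τ (z + μ) * theta τ γ) / (theta τ (z - γ) * theta τ μ)

/-- The elliptic dynamical R-matrix of `E_{τ,γ/2}(gl_N)` on `ℂ^N ⊗ ℂ^N`.
Entry `((i,j),(k,l))` is the coefficient of `e_i ⊗ e_j` in `R (e_k ⊗ e_l)`. -/
def Rmat (N : ℕ) (τ γ z : ℂ) (lam : Fin N → ℂ) :
    Matrix (Fin N × Fin N) (Fin N × Fin N) ℂ := fun p q =>
  if p.1 = p.2 then (if q = p then 1 else 0)
  else (if q = p then alphaF τ γ z (lam p.1 - lam p.2) else 0) +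
    (if q = (p.2, p.1) then betaF τ γ z (lam p.1 - lam p.2) else 0)

/-- `λ - γ ∑_{c ∈ S} h^{(c)}` evaluated on the configuration `g` of basis indices. -/
def shiftL {n N : ℕ} (γ : ℂ) (lam : Fin N → ℂ) (S : Finset (Fin n)) (g : Fin n → Fin N) :
    Fin N → ℂ :=
  fun i => lam i - γ * ((S.filter fun c => g c = i).card : ℂ)

/-- `R(z, λ - γ ∑_{c∈S} h^{(c)})^{(a b)}` acting on `(ℂ^N)^{⊗ n}`. -/
def Rop (N n : ℕ) (τ γ z : ℂ) (lam : Fin N → ℂ) (S : Finset (Fin n)) (a b : Fin n) :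
    Matrix (Fin n → Fin N) (Fin n → Fin N) ℂ := fun f g =>
  if ∀ c, c ≠ a → c ≠ b → f c = g c then
    Rmat N τ γ z (shiftL γ lam S g) (f a, f b) (g a, g b)
  else 0

/-- The operators `W_n(z,λ)`, defined recursively:  `W_1 = 1` and
`W_{n+1}(z,λ) = R(z_1-z_2, λ-γ∑_{j=3}^{n+1}h^{(j)})^{(12)} ⋯ R(z_1-z_{n+1},λ)^{(1 n+1)}
  (1 ⊗ W_n(z_2,…,z_{n+1}, λ-γh^{(1)}))` (tensor factors indexed `0,…,n`). -/
def Wrec (N : ℕ) (τ γ : ℂ) : (n : ℕ) → (Fin n → ℂ) → (Fin N → ℂ) →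
    Matrix (Fin n → Fin N) (Fin n → Fin N) ℂ
  | 0, _, _ => 1
  | n + 1, z, lam =>
    (((List.finRange n).map fun j : Fin n =>
      Rop N (n + 1) τ γ (z 0 - z j.succ) lam
        (Finset.univ.filter fun c : Fin (n + 1) => j.succ < c) 0 j.succ).prod) *
      Matrix.of (fun f g : Fin (n + 1) → Fin N =>
        if f 0 = g 0 then
          Wrec N τ γ n (fun j => z j.succ) (fun i => lam i - if g 0 = i then γ else 0)
            (Fin.tail f) (Fin.tail g)
        else 0)

/-- `W^S_n(λ) = W_n(z^S, λ)` with `z^S = (0, γ, 2γ, …, (n-1)γ)`. -/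
def WS (N n : ℕ) (τ γ : ℂ) (lam : Fin N → ℂ) :
    Matrix (Fin n → Fin N) (Fin n → Fin N) ℂ :=
  Wrec N τ γ n (fun j => ((j : ℕ) : ℂ) * γ) lam

/-- `z^∧ = ((n-1)γ, …, 2γ, γ, 0)`. -/
def zWedge (n : ℕ) (γ : ℂ) : Fin n → ℂ := fun j => ((n - 1 - (j : ℕ) : ℕ) : ℂ) * γ

/-- `W^∧_n(λ) = lim_{z → z^∧} ∏_{j=1}^{n-1} (z_j - z_{j+1} - γ) · ρ W_n(z,λ) ρ`,
where `ρ` reverses the order of the tensor factors. -/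
def Wwedge (N n : ℕ) (τ γ : ℂ) (lam : Fin N → ℂ) :
    Matrix (Fin n → Fin N) (Fin n → Fin N) ℂ :=
  limUnder (𝓝[≠] zWedge n γ) fun z : Fin n → ℂ =>
    (∏ j : Fin n, if h : (j : ℕ) + 1 < n then z j - z ⟨(j : ℕ) + 1, h⟩ - γ else 1) •
      Matrix.of fun f g : Fin n → Fin N => Wrec N τ γ n z lam (f ∘ Fin.rev) (g ∘ Fin.rev)

/-- The space `S²(ℂ^N)` of symmetric tensors in `ℂ^N ⊗ ℂ^N`. -/
def symPair (N : ℕ) : Submodule ℂ ((Fin N × Fin N) → ℂ) where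
  carrier := {v | ∀ p : Fin N × Fin N, v p = v (p.2, p.1)}
  add_mem' := by intro a b ha hb p; simp only [Pi.add_apply, ha p, hb p]
  zero_mem' := by intro p; rfl
  smul_mem' := by intro c v hv p; simp only [Pi.smul_apply, hv p]

/-- `R^{reg}(γ,λ) = lim_{z→γ} (z-γ) R(z,λ)`. -/
def Rreg (N : ℕ) (τ γ : ℂ) (lam : Fin N → ℂ) : Matrix (Fin N × Fin N) (Fin N × Fin N) ℂ :=
  limUnder (𝓝[≠] γ) fun z : ℂ => (z - γ) • Rmat N τ γ z lam

/-- The flip `P : u ⊗ v ↦ v ⊗ u` on `ℂ^N ⊗ ℂ^N`. -/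
def Pmat (N : ℕ) : Matrix (Fin N × Fin N) (Fin N × Fin N) ℂ := fun p q =>
  if q = (p.2, p.1) then 1 else 0

/-- The space `S^n(ℂ^N)` of symmetric tensors in `(ℂ^N)^{⊗n}`. -/
def symTensors (N n : ℕ) : Submodule ℂ ((Fin n → Fin N) → ℂ) where
  carrier := {v | ∀ (σ : Equiv.Perm (Fin n)) (f : Fin n → Fin N), v (f ∘ σ) = v f}
  add_mem' := by intro a b ha hb σ f; simp only [Pi.add_apply, ha σ f, hb σ f]
  zero_mem' := by intro σ f; rfl
  smul_mem' := by intro c v hv σ f; simp only [Pi.smul_apply, hv σ f]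

/-- `J_n(ℂ^N)`: the span of tensors `σ v - sign(σ) v`. -/
def Jspan (N n : ℕ) : Submodule ℂ ((Fin n → Fin N) → ℂ) :=
  Submodule.span ℂ {w | ∃ (σ : Equiv.Perm (Fin n)) (v : (Fin n → Fin N) → ℂ),
    w = (fun f => v (f ∘ σ)) - ((Equiv.Perm.sign σ : ℤ) : ℂ) • v}

/-- `ℂ^N ⊗ W ⊆ ℂ^N ⊗ (ℂ^N)^{⊗ n}` for a subspace `W ⊆ (ℂ^N)^{⊗ n}`. -/
def consSlice (N n : ℕ) (W : Submodule ℂ ((Fin n → Fin N) → ℂ)) :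
    Submodule ℂ ((Fin (n + 1) → Fin N) → ℂ) where
  carrier := {v | ∀ i : Fin N, (fun g : Fin n → Fin N => v (Fin.cons i g)) ∈ W}
  add_mem' := by intro a b ha hb i; exact W.add_mem (ha i) (hb i)
  zero_mem' := by intro i; exact W.zero_mem
  smul_mem' := by intro c v hv i; exact W.smul_mem c (hv i)

/-- The `L`-operator of `V^{⊗n}(w)`:
`L(z,λ) = R(z-w, λ-γ∑_{j=2}^n h^{(j)})^{(01)} ⋯ R(z-w-γ(n-1), λ)^{(0n)}`,
acting on `ℂ^N ⊗ (ℂ^N)^{⊗n}` with factors numbered `0,…,n`. -/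
def Lop (N n : ℕ) (τ γ z w : ℂ) (lam : Fin N → ℂ) :
    Matrix (Fin (n + 1) → Fin N) (Fin (n + 1) → Fin N) ℂ :=
  ((List.finRange n).map fun j : Fin n =>
    Rop N (n + 1) τ γ (z - w - (j : ℕ) * γ) lam
      (Finset.univ.filter fun c : Fin (n + 1) => j.succ < c) 0 j.succ).prod

/-- The `L`-operator for the opposite coproduct:
`L'(z,λ) = R(z-w-γ(n-1), λ-γ∑_{j=1}^{n-1} h^{(j)})^{(0n)} ⋯ R(z-w, λ)^{(01)}`. -/
def Lop' (N n : ℕ) (τ γ z w : ℂ) (lam : Fin N → ℂ) :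
    Matrix (Fin (n + 1) → Fin N) (Fin (n + 1) → Fin N) ℂ :=
  (((List.finRange n).reverse).map fun j : Fin n =>
    Rop N (n + 1) τ γ (z - w - (j : ℕ) * γ) lam
      (Finset.univ.filter fun c : Fin (n + 1) => 0 < c ∧ c < j.succ) 0 j.succ).prod

/-- `Id ⊗ M` on `ℂ^N ⊗ (ℂ^N)^{⊗n}`. -/
def idTensor (N n : ℕ) (M : Matrix (Fin n → Fin N) (Fin n → Fin N) ℂ) :
    Matrix (Fin (n + 1) → Fin N) (Fin (n + 1) → Fin N) ℂ :=
  Matrix.of fun f g => if f 0 = g 0 then M (Fin.tail f) (Fin.tail g) else 0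

/-- `Id ⊗ M(λ - γ h^{(0)})` on `ℂ^N ⊗ (ℂ^N)^{⊗n}`. -/
def idTensorShift (N n : ℕ) (γ : ℂ)
    (M : (Fin N → ℂ) → Matrix (Fin n → Fin N) (Fin n → Fin N) ℂ) (lam : Fin N → ℂ) :
    Matrix (Fin (n + 1) → Fin N) (Fin (n + 1) → Fin N) ℂ :=
  Matrix.of fun f g =>
    if f 0 = g 0 then M (fun i => lam i - if g 0 = i then γ else 0) (Fin.tail f) (Fin.tail g)
    else 0

/-- The zero-weight symmetric tensor `e`: the sum of all `e_{i_1} ⊗ ⋯ ⊗ e_{i_n}` over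
sequences in which each index occurs exactly `ℓ` times. -/
def evec (N n ℓ : ℕ) : (Fin n → Fin N) → ℂ := fun f =>
  if ∀ i : Fin N, (Finset.univ.filter fun j => f j = i).card = ℓ then 1 else 0

/-- The multi-index of `ē = e_1^{⊗ℓ} ⊗ ⋯ ⊗ e_N^{⊗ℓ}`. -/
def barIdx (N ℓ : ℕ) : Fin (N * ℓ) → Fin N := fun j =>
  ⟨j.val / ℓ, by
    have h : (j : ℕ) < ℓ * N := by rw [Nat.mul_comm ℓ N]; exact j.isLt
    exact Nat.div_lt_of_lt_mul h⟩

/-- `g_{N,ℓ}(λ) = ∏_{1≤j<k≤N} ∏_{s=1}^ℓ θ(λ_j-λ_k+γs)/θ(λ_j-λ_k-γ(s-1))`. -/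
def gfun (N ℓ : ℕ) (τ γ : ℂ) (lam : Fin N → ℂ) : ℂ :=
  ∏ j : Fin N, ∏ k : Fin N,
    if j < k then
      ∏ s ∈ Finset.Icc 1 ℓ,
        theta τ (lam j - lam k + γ * (s : ℂ)) / theta τ (lam j - lam k - γ * ((s : ℂ) - 1))
    else 1

/-- The permutation induced by a word in the generators `s_1, …, s_n` of `S_{n+1}`:
`π_k = s_{a_1} ∘ ⋯ ∘ s_{a_k}` (letters `a` act as the transposition of `a` and `a+1`). -/
def permOfWord {n : ℕ} : List (Fin n) → Equiv.Perm (Fin (n + 1))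
  | [] => 1
  | a :: rest => Equiv.swap a.castSucc a.succ * permOfWord rest

/-- The product of R-matrices attached to a word (with accumulated permutation `π`):
`W_w(z,λ) = F_k ⋯ F_1` where for the `t`-th letter `a`
`F_t = R(z_{π(a)} - z_{π(a+1)}, λ - γ ∑_{b<a} h^{(π(b))})^{(π(a), π(a+1))}`,
`π = π_{t-1}` the permutation induced by the earlier letters. -/
def Wword (N : ℕ) {n : ℕ} (τ γ : ℂ) (z : Fin (n + 1) → ℂ) (lam : Fin N → ℂ) :
    List (Fin n) → Equiv.Perm (Fin (n + 1)) →
      Matrix (Fin (n + 1) → Fin N) (Fin (n + 1) → Fin N) ℂ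
  | [], _ => 1
  | a :: rest, π =>
      Wword N τ γ z lam rest (π * Equiv.swap a.castSucc a.succ) *
        Rop N (n + 1) τ γ (z (π a.castSucc) - z (π a.succ)) lam
          ((Finset.univ.filter fun c : Fin (n + 1) => (c : ℕ) < (a : ℕ)).image π)
          (π a.castSucc) (π a.succ)

/-- The fused R-matrix `𝓡_{V^{⊗m}(z), V^{⊗n}(w)}(λ)` on `(ℂ^N)^{⊗(m+n)}`
(first block: factors `0,…,m-1`; second block: factors `m,…,m+n-1`). -/
def Rmn (N m n : ℕ) (τ γ z w : ℂ) (lam : Fin N → ℂ) :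
    Matrix (Fin (m + n) → Fin N) (Fin (m + n) → Fin N) ℂ :=
  ((List.finRange m).map fun a : Fin m =>
    ((List.finRange n).map fun j : Fin n =>
      Rop N (m + n) τ γ (z + (a : ℕ) * γ - w - (j : ℕ) * γ) lam
        (Finset.univ.filter fun c : Fin (m + n) =>
          (c : ℕ) < (a : ℕ) ∨ m + (j : ℕ) < (c : ℕ))
        (Fin.castAdd n a) (Fin.natAdd m j)).prod).prod

/-- `A ⊗ B ⊆ (ℂ^N)^{⊗m} ⊗ (ℂ^N)^{⊗n}`, realised as `(A ⊗ V₂) ∩ (V₁ ⊗ B)`. -/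
def blockSub (N m n : ℕ) (A : Submodule ℂ ((Fin m → Fin N) → ℂ))
    (B : Submodule ℂ ((Fin n → Fin N) → ℂ)) :
    Submodule ℂ ((Fin (m + n) → Fin N) → ℂ) where
  carrier := {v |
    (∀ g : Fin n → Fin N, (fun f : Fin m → Fin N => v (Fin.append f g)) ∈ A) ∧
    ∀ f : Fin m → Fin N, (fun g : Fin n → Fin N => v (Fin.append f g)) ∈ B}
  add_mem' := by
    intro x y hx hy
    exact ⟨fun g => A.add_mem (hx.1 g) (hy.1 g), fun f => B.add_mem (hx.2 f) (hy.2 f)⟩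
  zero_mem' := ⟨fun _ => A.zero_mem, fun _ => B.zero_mem⟩
  smul_mem' := by
    intro c x hx
    exact ⟨fun g => A.smul_mem c (hx.1 g), fun f => B.smul_mem c (hx.2 f)⟩

/-- Matrix element `L_{jk}(z,λ)` of the `L`-operator (evaluation point `w = 0`),
as an operator on `(ℂ^N)^{⊗n}`: `L(z,λ)(e_k ⊗ v) = ∑_j e_j ⊗ L_{jk}(z,λ) v`. -/
def LmatEl (N n : ℕ) (τ γ z : ℂ) (lam : Fin N → ℂ) (j k : Fin N)
    (v : (Fin n → Fin N) → ℂ) : (Fin n → Fin N) → ℂ := fun g =>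
  (Lop N n τ γ z 0 lam).mulVec
    (fun f => (if f 0 = k then (1 : ℂ) else 0) * v (Fin.tail f)) (Fin.cons j g)

/-- `L_{j_{σ(1)} j_1}(z, λ-γ(ω_{j_2}+⋯+ω_{j_m})) ∘ ⋯ ∘ L_{j_{σ(m)} j_m}(z-(m-1)γ, λ)`. -/
def chainT (N n m : ℕ) (τ γ z : ℂ) (lam : Fin N → ℂ) (jt : Fin m → Fin N)
    (σ : Equiv.Perm (Fin m)) (v : (Fin n → Fin N) → ℂ) : (Fin n → Fin N) → ℂ :=
  (List.finRange m).foldr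
    (fun (t : Fin m) acc =>
      LmatEl N n τ γ (z - (t.val : ℂ) * γ)
        (fun i => lam i -
          γ * ((Finset.univ.filter fun s : Fin m => t < s ∧ jt s = i).card : ℂ))
        (jt (σ t)) (jt t) acc)
    v

/-- The transfer matrix `T_m(z)`, acting on scalar functions of `λ` via the identification
of the zero weight space of `S^{Nℓ}(ℂ^N)` with `ℂ` by the basis vector `e`:
`T_m(z) f(λ) = ∑_{j_1<⋯<j_m} ∑_{σ} (-1)^σ [L_{j_{σ(1)} j_1}(z,λ-γ(ω_{j_2}+⋯+ω_{j_m})) ⋯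
L_{j_{σ(m)} j_m}(z-(m-1)γ, λ)] e · f(λ-γ(ω_{j_1}+⋯+ω_{j_m}))`. -/
def Tm (N ℓ m : ℕ) (τ γ z : ℂ) (lam : Fin N → ℂ) (f : (Fin N → ℂ) → ℂ) : ℂ :=
  ∑ jt ∈ Finset.univ.filter fun jt : Fin m → Fin N => ∀ s t : Fin m, s < t → jt s < jt t,
    ∑ σ : Equiv.Perm (Fin m),
      ((Equiv.Perm.sign σ : ℤ) : ℂ) *
        chainT N (N * ℓ) m τ γ z lam jt σ (evec N (N * ℓ) ℓ) (barIdx N ℓ) *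
        f fun i => lam i - if ∃ t, jt t = i then γ else 0

/-- The `m`-th Ruijsenaars operator with coupling constant `ℓ`:
`M_m f(λ) = ∑_{|J|=m} ∏_{j∈J,k∉J} θ(λ_j-λ_k+ℓγ)/θ(λ_j-λ_k) · f(λ-γ∑_{j∈J}ω_j)`. -/
def Mm (N ℓ m : ℕ) (τ γ : ℂ) (f : (Fin N → ℂ) → ℂ) (lam : Fin N → ℂ) : ℂ :=
  ∑ J ∈ Finset.powersetCard m (Finset.univ : Finset (Fin N)),
    (∏ j ∈ J, ∏ k ∈ Jᶜ, theta τ (lam j - lam k + (ℓ : ℂ) * γ) / theta τ (lam j - lam k)) *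
      f fun i => lam i - if i ∈ J then γ else 0

/-- The transfer matrix with auxiliary space indexed by `ι` (weights `wt`) and quantum
space indexed by `ι₃`: `T f(λ) = ∑_μ tr_{W[μ]}(𝓡(λ)) f(λ-γμ)`. -/
def transferOp {N : ℕ} {ι ι₃ : Type} [Fintype ι] [Fintype ι₃] (γ : ℂ)
    (wt : ι → Fin N → ℂ) (R : (Fin N → ℂ) → Matrix (ι × ι₃) (ι × ι₃) ℂ)
    (f : (Fin N → ℂ) → ι₃ → ℂ) : (Fin N → ℂ) → ι₃ → ℂ := fun lam b =>
  ∑ a : ι, ∑ b' : ι₃, R lam (a, b) (a, b') * f (fun r => lam r - γ * wt a r) b'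


/-- The summands of the (negated) theta series. -/
def thetaTerm (τ z : ℂ) (j : ℤ) : ℂ :=
  Complex.exp ((Real.pi : ℂ) * Complex.I * ((j : ℂ) + 1 / 2) ^ 2 * τ +
      2 * (Real.pi : ℂ) * Complex.I * ((j : ℂ) + 1 / 2) * (z + 1 / 2))

/-- The prefactor relating `theta` to `jacobiTheta₂`. -/
def thetaFactor (τ z : ℂ) : ℂ :=
  Complex.exp ((Real.pi : ℂ) * Complex.I * τ / 4 + (Real.pi : ℂ) * Complex.I * (z + 1 / 2))

lemma thetaTerm_eq (τ z : ℂ) (j : ℤ) :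
    thetaTerm τ z j = thetaFactor τ z * jacobiTheta₂_term j (z + 1 / 2 + τ / 2) τ := by
  rw [thetaTerm, thetaFactor, jacobiTheta₂_term, ← Complex.exp_add]
  ring_nf

lemma theta_eq_neg_tsum (τ z : ℂ) : theta τ z = -∑' j, thetaTerm τ z j := rfl

lemma theta_eq (τ z : ℂ) :
    theta τ z = -(thetaFactor τ z * jacobiTheta₂ (z + 1 / 2 + τ / 2) τ) := by
  simp_rw [theta_eq_neg_tsum, thetaTerm_eq, tsum_mul_left, jacobiTheta₂]

lemma summable_thetaTerm {τ : ℂ} (hτ : 0 < τ.im) (z : ℂ) : Summable (thetaTerm τ z) := by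
  simpa only [funext (thetaTerm_eq τ z)] using
    ((summable_jacobiTheta₂_term_iff _ τ).2 hτ).mul_left (thetaFactor τ z)

lemma differentiable_theta {τ : ℂ} (hτ : 0 < τ.im) : Differentiable ℂ (theta τ) := by
  have h : theta τ = fun z => -(thetaFactor τ z * jacobiTheta₂ (z + 1 / 2 + τ / 2) τ) :=
    funext (theta_eq τ)
  rw [h]
  intro z
  refine (DifferentiableAt.mul ?_ ?_).neg
  · unfold thetaFactor
    fun_prop
  · exact (differentiableAt_jacobiTheta₂_fst _ hτ).comp z (by fun_prop)

/-- The even degree two theta series `∑_{p even} e^{πip²τ/2 + 2πipx}`. -/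
def thetaEven (τ x : ℂ) : ℂ := jacobiTheta₂ (2 * x) (2 * τ)

/-- The odd degree two theta series `∑_{p odd} e^{πip²τ/2 + 2πipx}`. -/
def thetaOdd (τ x : ℂ) : ℂ :=
  Complex.exp ((Real.pi : ℂ) * Complex.I * τ / 2 + 2 * (Real.pi : ℂ) * Complex.I * x) *
    jacobiTheta₂ (2 * x + τ) (2 * τ)

lemma differentiable_thetaEven {τ : ℂ} (hτ : 0 < τ.im) : Differentiable ℂ (thetaEven τ) :=
  fun x => (differentiableAt_jacobiTheta₂_fst (2 * x) (τ := 2 * τ) (by simpa)).comp x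
    (by fun_prop)

lemma differentiable_thetaOdd {τ : ℂ} (hτ : 0 < τ.im) : Differentiable ℂ (thetaOdd τ) := by
  intro x
  unfold thetaOdd
  refine DifferentiableAt.mul (by fun_prop) ?_
  exact (differentiableAt_jacobiTheta₂_fst (2 * x + τ) (τ := 2 * τ) (by simpa)).comp x
    (f := fun x => 2 * x + τ) (by fun_prop)

/-- The summands of `thetaEven`. -/
def thetaEvenTerm (τ x : ℂ) (a : ℤ) : ℂ := jacobiTheta₂_term a (2 * x) (2 * τ)

/-- The summands of `thetaOdd`. -/
def thetaOddTerm (τ x : ℂ) (b : ℤ) : ℂ :=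
  Complex.exp ((Real.pi : ℂ) * Complex.I * τ / 2 + 2 * (Real.pi : ℂ) * Complex.I * x) *
    jacobiTheta₂_term b (2 * x + τ) (2 * τ)

lemma hasSum_thetaEvenTerm {τ : ℂ} (hτ : 0 < τ.im) (x : ℂ) :
    HasSum (thetaEvenTerm τ x) (thetaEven τ x) :=
  hasSum_jacobiTheta₂_term (2 * x) (τ := 2 * τ) (by simpa)

lemma hasSum_thetaOddTerm {τ : ℂ} (hτ : 0 < τ.im) (x : ℂ) :
    HasSum (thetaOddTerm τ x) (thetaOdd τ x) :=
  (hasSum_jacobiTheta₂_term (2 * x + τ) (τ := 2 * τ) (by simpa)).mul_left _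

lemma thetaEven_add_half (τ x : ℂ) : thetaEven τ (x + 1 / 2) = thetaEven τ x := by
  rw [thetaEven, thetaEven, show 2 * (x + 1 / 2) = 2 * x + 1 by ring, jacobiTheta₂_add_left]

lemma thetaOdd_add_half (τ x : ℂ) : thetaOdd τ (x + 1 / 2) = -thetaOdd τ x := by
  rw [thetaOdd, thetaOdd, show 2 * (x + 1 / 2) + τ = 2 * x + τ + 1 by ring,
    jacobiTheta₂_add_left,
    show (Real.pi : ℂ) * Complex.I * τ / 2 + 2 * (Real.pi : ℂ) * Complex.I * (x + 1 / 2) =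
      ((Real.pi : ℂ) * Complex.I * τ / 2 + 2 * (Real.pi : ℂ) * Complex.I * x) +
        (Real.pi : ℂ) * Complex.I by ring, Complex.exp_add _ ((Real.pi : ℂ) * Complex.I),
    Complex.exp_pi_mul_I]
  ring

/-- Pairs of integers split according to the parity of their sum. -/
def parityEquiv : (ℤ × ℤ) ⊕ (ℤ × ℤ) ≃ ℤ × ℤ :=
  Equiv.ofBijective
    (Sum.elim (fun p => (p.1 + p.2, p.1 - p.2 - 1)) (fun p => (p.1 + p.2, p.1 - p.2))) <| by
    constructor
    · rintro (⟨a, b⟩ | ⟨a, b⟩) (⟨c, d⟩ | ⟨c, d⟩) h <;>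
        simp only [Sum.elim_inl, Sum.elim_inr, Prod.mk.injEq] at h <;>
        simp only [Sum.inl.injEq, Sum.inr.injEq, Prod.mk.injEq, reduceCtorEq] <;> omega
    · rintro ⟨m, n⟩
      rcases Int.even_or_odd' (m + n) with ⟨k, hk | hk⟩
      · exact ⟨Sum.inr (k, m - k), by
          simp only [Sum.elim_inr, Prod.mk.injEq]; omega⟩
      · exact ⟨Sum.inl (k + 1, m - k - 1), by
          simp only [Sum.elim_inl, Prod.mk.injEq]; omega⟩

lemma parityEquiv_inl (p : ℤ × ℤ) :
    parityEquiv (Sum.inl p) = (p.1 + p.2, p.1 - p.2 - 1) := rfl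

lemma parityEquiv_inr (p : ℤ × ℤ) :
    parityEquiv (Sum.inr p) = (p.1 + p.2, p.1 - p.2) := rfl

lemma thetaTerm_mul_thetaTerm_even (τ x y : ℂ) (a b : ℤ) :
    thetaTerm τ (x + y) (a + b) * thetaTerm τ (x - y) (a - b - 1) =
      thetaEvenTerm τ x a * thetaOddTerm τ y b := by
  simp only [thetaTerm, thetaEvenTerm, thetaOddTerm, jacobiTheta₂_term]
  rw [← Complex.exp_add, ← Complex.exp_add, ← Complex.exp_add, Complex.exp_eq_exp_iff_exists_int]
  refine ⟨a, ?_⟩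
  push_cast
  ring

lemma thetaTerm_mul_thetaTerm_odd (τ x y : ℂ) (a b : ℤ) :
    thetaTerm τ (x + y) (a + b) * thetaTerm τ (x - y) (a - b) =
      -(thetaOddTerm τ x a * thetaEvenTerm τ y b) := by
  simp only [thetaTerm, thetaEvenTerm, thetaOddTerm, jacobiTheta₂_term]
  rw [← Complex.exp_add, ← Complex.exp_add, ← Complex.exp_add, ← mul_neg_one,
    ← Complex.exp_pi_mul_I, ← Complex.exp_add, Complex.exp_eq_exp_iff_exists_int]
  refine ⟨a, ?_⟩
  push_cast
  ring

/-- Addition formula: `θ(x+y)θ(x-y)` in terms of the degree two theta series. -/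
lemma theta_add_mul_theta_sub {τ : ℂ} (hτ : 0 < τ.im) (x y : ℂ) :
    theta τ (x + y) * theta τ (x - y) =
      thetaEven τ x * thetaOdd τ y - thetaOdd τ x * thetaEven τ y := by
  have hE := hasSum_thetaEvenTerm hτ
  have hO := hasSum_thetaOddTerm hτ
  have hEO : HasSum (fun p : ℤ × ℤ =>
      thetaTerm τ (x + y) (p.1 + p.2) * thetaTerm τ (x - y) (p.1 - p.2 - 1))
      (thetaEven τ x * thetaOdd τ y) := by
    simp only [thetaTerm_mul_thetaTerm_even]
    exact (hE x).mul (hO y)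
      (summable_mul_of_summable_norm (hE x).summable.norm (hO y).summable.norm)
  have hOE : HasSum (fun p : ℤ × ℤ =>
      thetaTerm τ (x + y) (p.1 + p.2) * thetaTerm τ (x - y) (p.1 - p.2))
      (-(thetaOdd τ x * thetaEven τ y)) := by
    simp only [thetaTerm_mul_thetaTerm_odd]
    exact ((hO x).mul (hE y)
      (summable_mul_of_summable_norm (hO x).summable.norm (hE y).summable.norm)).neg
  rw [theta_eq_neg_tsum, theta_eq_neg_tsum, neg_mul_neg,
    tsum_mul_tsum_of_summable_norm (summable_thetaTerm hτ _).norm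
      (summable_thetaTerm hτ _).norm, ← parityEquiv.tsum_eq,
    sub_eq_add_neg (thetaEven τ x * thetaOdd τ y)]
  refine HasSum.tsum_eq (HasSum.sum ?_ ?_)
  · simpa only [Function.comp_def, parityEquiv_inl] using hEO
  · simpa only [Function.comp_def, parityEquiv_inr] using hOE

lemma integral_exp_two_pi_int (n : ℤ) :
    ∫ x in (0 : ℝ)..1, Complex.exp (2 * Real.pi * Complex.I * n * x) = if n = 0 then 1 else 0 := by
  split_ifs with h
  · simp [h]
  · have hc : 2 * (Real.pi : ℂ) * Complex.I * n ≠ 0 :=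
      mul_ne_zero Complex.two_pi_I_ne_zero (by exact_mod_cast h)
    rw [integral_exp_mul_complex hc, Complex.ofReal_one, mul_one,
      mul_comm (2 * (Real.pi : ℂ) * Complex.I) (n : ℂ), Complex.exp_int_mul_two_pi_mul_I]
    simp

lemma integral_jacobiTheta₂ {τ : ℂ} (hτ : 0 < τ.im) :
    ∫ x in (0 : ℝ)..1, jacobiTheta₂ x τ = 1 := by
  let f : ℤ → C(ℝ, ℂ) := fun n =>
    ⟨fun x => jacobiTheta₂_term n x τ, by unfold jacobiTheta₂_term; fun_prop⟩
  have hint : ∀ n, ∫ x in (0 : ℝ)..1, f n x = if n = 0 then 1 else 0 := by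
    intro n
    simp only [f, ContinuousMap.coe_mk, jacobiTheta₂_term, Complex.exp_add,
      intervalIntegral.integral_mul_const, integral_exp_two_pi_int]
    split_ifs with h <;> simp [h]
  have hsum : Summable fun n : ℤ => ‖(f n).restrict
      (⟨Set.uIcc 0 1, isCompact_uIcc⟩ : TopologicalSpace.Compacts ℝ)‖ := by
    refine Summable.of_nonneg_of_le (fun _ => norm_nonneg _) (fun n => ?_)
      ((summable_jacobiTheta₂_term_iff 0 τ).2 hτ).norm
    refine (ContinuousMap.norm_le _ (norm_nonneg _)).2 fun x => le_of_eq ?_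
    simp [f, norm_jacobiTheta₂_term]
  have h := intervalIntegral.tsum_intervalIntegral_eq_of_summable_norm hsum
  simp only [hint, tsum_ite_eq] at h
  exact h.symm

lemma exists_theta_ne_zero {τ : ℂ} (hτ : 0 < τ.im) : ∃ z, theta τ z ≠ 0 := by
  by_contra! h
  have h0 : ∀ w, jacobiTheta₂ w τ = 0 := fun w => by
    have := h (w - 1 / 2 - τ / 2)
    rw [theta_eq, neg_eq_zero, show w - 1 / 2 - τ / 2 + 1 / 2 + τ / 2 = w by ring] at this
    exact (mul_eq_zero.1 this).resolve_left (Complex.exp_ne_zero _)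
  simpa [h0] using integral_jacobiTheta₂ hτ

lemma theta_zero {τ : ℂ} (hτ : 0 < τ.im) : theta τ 0 = 0 := by
  obtain ⟨z, hz⟩ := exists_theta_ne_zero hτ
  have h := theta_add_mul_theta_sub hτ (z / 2) (z / 2)
  rw [add_halves, sub_self, mul_comm (thetaEven _ _), sub_self] at h
  exact (mul_eq_zero.1 h).resolve_left hz

lemma thetaEven_ne_zero {τ : ℂ} (hτ : 0 < τ.im) : ∃ x, thetaEven τ x ≠ 0 := by
  by_contra! h
  obtain ⟨z, hz⟩ := exists_theta_ne_zero hτ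
  have h1 := theta_add_mul_theta_sub hτ z 0
  simp [h, hz] at h1

/-- If `θ'(0) = 0`, the Wronskian of the degree two theta series vanishes. -/
lemma wronskian_eq_zero {τ : ℂ} (hτ : 0 < τ.im) (h : deriv (theta τ) 0 = 0) (y : ℂ) :
    deriv (thetaEven τ) y * thetaOdd τ y - deriv (thetaOdd τ) y * thetaEven τ y = 0 := by
  have hθ := differentiable_theta hτ
  have hR : HasDerivAt (fun x => thetaEven τ x * thetaOdd τ y - thetaOdd τ x * thetaEven τ y)
      (deriv (thetaEven τ) y * thetaOdd τ y - deriv (thetaOdd τ) y * thetaEven τ y) y :=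
    ((differentiable_thetaEven hτ y).hasDerivAt.mul_const _).sub
      ((differentiable_thetaOdd hτ y).hasDerivAt.mul_const _)
  have h0 : HasDerivAt (theta τ) 0 (y - y) := by
    simpa [h] using (hθ 0).hasDerivAt
  have hL := ((hθ (y + y)).hasDerivAt.comp_add_const y y).mul (h0.comp_sub_const y y)
  have hL' : HasDerivAt (fun x => thetaEven τ x * thetaOdd τ y - thetaOdd τ x * thetaEven τ y)
      0 y := by
    simp only [← theta_add_mul_theta_sub hτ]
    simpa [theta_zero hτ] using! hL
  exact hR.unique hL'

/-- The zero of `θ` at the origin is simple. -/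
lemma deriv_theta_zero_ne_zero {τ : ℂ} (hτ : 0 < τ.im) : deriv (theta τ) 0 ≠ 0 := by
  intro h
  have hE := differentiable_thetaEven hτ
  have hO := differentiable_thetaOdd hτ
  obtain ⟨x₀, hx₀⟩ := thetaEven_ne_zero hτ
  obtain ⟨r, hr, hball⟩ := Metric.eventually_nhds_iff_ball.1
    (hE.continuous.continuousAt.eventually_ne hx₀)
  have hd : ∀ x ∈ Metric.ball x₀ r,
      HasDerivAt (fun x => thetaOdd τ x / thetaEven τ x) 0 x := fun x hx => by
    have h1 := (hO x).hasDerivAt.fun_div (hE x).hasDerivAt (hball x hx)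
    have h2 : deriv (thetaOdd τ) x * thetaEven τ x - thetaOdd τ x * deriv (thetaEven τ) x = 0 := by
      linear_combination -wronskian_eq_zero hτ h x
    rwa [h2, zero_div] at h1
  obtain ⟨c, hc⟩ := Metric.isOpen_ball.exists_is_const_of_deriv_eq_zero
    (convex_ball x₀ r).isPreconnected
    (fun x hx => (hd x hx).differentiableAt.differentiableWithinAt)
    (fun x hx => (hd x hx).deriv)
  have heq : thetaOdd τ = fun x => c * thetaEven τ x := by
    refine AnalyticOnNhd.eq_of_eventuallyEq (z₀ := x₀)
      (hO.differentiableOn.analyticOnNhd isOpen_univ)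
      ((hE.const_mul c).differentiableOn.analyticOnNhd isOpen_univ) ?_
    filter_upwards [Metric.ball_mem_nhds x₀ hr] with x hx
    rw [← hc x hx, div_mul_cancel₀ _ (hball x hx)]
  have hO0 : ∀ x, thetaOdd τ x = 0 := fun x => by
    have h1 := thetaOdd_add_half τ x
    have h2 := congrFun heq (x + 1 / 2)
    have h3 := congrFun heq x
    simp only [thetaEven_add_half] at h2
    linear_combination (h1 - h2 + h3) / 2
  obtain ⟨z, hz⟩ := exists_theta_ne_zero hτ
  have h1 := theta_add_mul_theta_sub hτ z 0
  simp [hO0, hz] at h1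

lemma tendsto_div_theta {τ : ℂ} (hτ : 0 < τ.im) (γ : ℂ) :
    Tendsto (fun z => (z - γ) / theta τ (z - γ)) (𝓝[≠] γ) (𝓝 (deriv (theta τ) 0)⁻¹) := by
  have h0 : HasDerivAt (theta τ) (deriv (theta τ) 0) (γ - γ) := by
    simpa using (differentiable_theta hτ 0).hasDerivAt
  have h := (h0.comp_sub_const γ γ).tendsto_slope.inv₀ (deriv_theta_zero_ne_zero hτ)
  refine h.congr fun z => ?_
  simp [slope_def_field, theta_zero hτ]

lemma tendsto_mul_alphaF {τ : ℂ} (hτ : 0 < τ.im) (γ μ : ℂ) :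
    Tendsto (fun z => (z - γ) * alphaF τ γ z μ) (𝓝[≠] γ)
      (𝓝 ((deriv (theta τ) 0)⁻¹ * (theta τ γ * theta τ (μ + γ) / theta τ μ))) := by
  have hθ := (differentiable_theta hτ).continuous
  have hc : Tendsto (fun z => theta τ z * theta τ (μ + γ) / theta τ μ) (𝓝[≠] γ)
      (𝓝 (theta τ γ * theta τ (μ + γ) / theta τ μ)) :=
    (((hθ.tendsto γ).mul_const _).div_const _).mono_left nhdsWithin_le_nhds
  refine ((tendsto_div_theta hτ γ).mul hc).congr fun z => ?_
  rw [alphaF]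
  ring

lemma tendsto_mul_betaF {τ : ℂ} (hτ : 0 < τ.im) (γ μ : ℂ) :
    Tendsto (fun z => (z - γ) * betaF τ γ z μ) (𝓝[≠] γ)
      (𝓝 (-((deriv (theta τ) 0)⁻¹ * (theta τ γ * theta τ (μ + γ) / theta τ μ)))) := by
  have hθ := (differentiable_theta hτ).continuous
  have hc : Tendsto (fun z => -(theta τ (z + μ) * theta τ γ) / theta τ μ) (𝓝[≠] γ)
      (𝓝 (-(theta τ (γ + μ) * theta τ γ) / theta τ μ)) := by
    have : Continuous fun z => -(theta τ (z + μ) * theta τ γ) / theta τ μ := by fun_prop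
    exact (this.tendsto γ).mono_left nhdsWithin_le_nhds
  have h := (tendsto_div_theta hτ γ).mul hc
  rw [add_comm γ μ, show (deriv (theta τ) 0)⁻¹ * (-(theta τ (μ + γ) * theta τ γ) / theta τ μ) =
    -((deriv (theta τ) 0)⁻¹ * (theta τ γ * theta τ (μ + γ) / theta τ μ)) by ring] at h
  refine h.congr fun z => ?_
  rw [betaF]
  ring

lemma tendsto_smul_Rmat {N : ℕ} {τ : ℂ} (hτ : 0 < τ.im) (γ : ℂ) (lam : Fin N → ℂ) :
    Tendsto (fun z : ℂ => (z - γ) • Rmat N τ γ z lam) (𝓝[≠] γ)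
      (𝓝 (Matrix.of fun p q => if p.1 = p.2 then 0 else
        (deriv (theta τ) 0)⁻¹ * (theta τ γ * theta τ (lam p.1 - lam p.2 + γ) /
          theta τ (lam p.1 - lam p.2)) *
          ((if q = p then 1 else 0) - (if q = (p.2, p.1) then 1 else 0)))) := by
  refine tendsto_pi_nhds.2 fun p => tendsto_pi_nhds.2 fun q => ?_
  simp only [Matrix.smul_apply, Rmat, smul_eq_mul, Matrix.of_apply]
  have hid : Tendsto (fun z : ℂ => z - γ) (𝓝[≠] γ) (𝓝 0) := by
    have : Continuous fun z : ℂ => z - γ := by fun_prop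
    simpa using (this.tendsto γ).mono_left nhdsWithin_le_nhds
  have hα := tendsto_mul_alphaF hτ γ (lam p.1 - lam p.2)
  have hβ := tendsto_mul_betaF hτ γ (lam p.1 - lam p.2)
  by_cases hp : p.1 = p.2
  · simp only [hp, if_true]
    split_ifs
    · simpa using hid
    · simp
  · simp only [hp, if_false]
    split_ifs
    · simpa [mul_add] using hα.add hβ
    · simpa using hα
    · simpa using hβ
    · simp

/-- The nonvanishing locus of a theta function composed with a nonzero linear form is open
and dense. -/
lemma isOpen_dense_theta_comp_ne_zero {E : Type*} [NormedAddCommGroup E] [NormedSpace ℂ E]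
    {τ : ℂ} (hτ : 0 < τ.im) {f : E →L[ℂ] ℂ} (hf : f ≠ 0) :
    IsOpen {x | theta τ (f x) ≠ 0} ∧ Dense {x | theta τ (f x) ≠ 0} := by
  have hθ := differentiable_theta hτ
  refine ⟨isOpen_ne_fun (hθ.continuous.comp f.continuous) continuous_const, ?_⟩
  have hd : Dense {z | theta τ z ≠ 0} := by
    change Dense {z | theta τ z = 0}ᶜ
    rw [← interior_eq_empty_iff_dense_compl]
    by_contra hne
    obtain ⟨z₀, hz₀⟩ := Set.nonempty_iff_ne_empty.2 hne
    obtain ⟨z, hz⟩ := exists_theta_ne_zero hτ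
    exact hz (congrFun (AnalyticOnNhd.eq_of_eventuallyEq (z₀ := z₀) (g := fun _ => 0)
      (hθ.differentiableOn.analyticOnNhd isOpen_univ) analyticOnNhd_const
      (mem_interior_iff_mem_nhds.1 hz₀)) z)
  exact hd.preimage (f.isOpenMap_of_ne_zero hf)

lemma ker_mulVecLin_Rreg {N : ℕ} {τ : ℂ} (hτ : 0 < τ.im) {γ : ℂ} {lam : Fin N → ℂ}
    (hγ : theta τ γ ≠ 0)
    (hlam : ∀ i j, i ≠ j → theta τ (lam i - lam j) ≠ 0 ∧ theta τ (lam i - lam j + γ) ≠ 0) :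
    LinearMap.ker (Matrix.mulVecLin (Rreg N τ γ lam)) = symPair N := by
  have hd := deriv_theta_zero_ne_zero hτ
  rw [Rreg, (tendsto_smul_Rmat hτ γ lam).limUnder_eq]
  ext v
  rw [LinearMap.mem_ker, Matrix.mulVecLin_apply, funext_iff]
  refine forall_congr' fun p => ?_
  by_cases hp : p.1 = p.2
  · obtain ⟨i, j⟩ := p
    obtain rfl : i = j := hp
    simp [Matrix.mulVec, dotProduct]
  · obtain ⟨h1, h2⟩ := hlam _ _ hp
    simp [Matrix.mulVec, dotProduct, hp, mul_assoc, sub_mul, ← Finset.mul_sum,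
      Finset.sum_sub_distrib, hd, h1, h2, hγ, sub_eq_zero]

/-- for generic `(γ,λ)` the kernel of `R^{reg}(γ,λ) = res_{z=γ} R(z,λ)`
is `S²(ℂ^N)`. -/
theorem kernel_Rreg (N : ℕ) (hN : 2 ≤ N) (τ : ℂ) (hτ : 0 < τ.im) :
    ∃ U : Set (ℂ × (Fin N → ℂ)), IsOpen U ∧ Dense U ∧
      ∀ γ : ℂ, ∀ lam : Fin N → ℂ, (γ, lam) ∈ U →
        LinearMap.ker (Matrix.mulVecLin (Rreg N τ γ lam)) = symPair N := by
  let fst : ℂ × (Fin N → ℂ) →L[ℂ] ℂ := ContinuousLinearMap.fst ℂ ℂ (Fin N → ℂ)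
  let d : Fin N × Fin N → ℂ × (Fin N → ℂ) →L[ℂ] ℂ := fun p =>
    (ContinuousLinearMap.proj (R := ℂ) (φ := fun _ : Fin N => ℂ) p.1 -
      ContinuousLinearMap.proj (R := ℂ) (φ := fun _ : Fin N => ℂ) p.2).comp
      (ContinuousLinearMap.snd ℂ ℂ (Fin N → ℂ))
  have hfst : fst ≠ 0 := fun h => by simpa [fst] using DFunLike.congr_fun h (1, 0)
  have hd : ∀ p : {p : Fin N × Fin N // p.1 ≠ p.2}, d p ≠ 0 := fun p h => by
    simpa [d, p.2] using DFunLike.congr_fun h (0, Pi.single p.1.1 1)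
  have hd' : ∀ p, d p + fst ≠ 0 := fun p h => by
    simpa [d, fst] using DFunLike.congr_fun h (1, 0)
  have key := fun p : {p : Fin N × Fin N // p.1 ≠ p.2} =>
    And.intro (isOpen_dense_theta_comp_ne_zero hτ (hd p))
      (isOpen_dense_theta_comp_ne_zero hτ (hd' p))
  have h0 := isOpen_dense_theta_comp_ne_zero hτ hfst
  have hop := isOpen_iInter_of_finite fun p => (key p).1.1.inter (key p).2.1
  have hde := dense_iInter_of_isOpen (fun p => (key p).1.1.inter (key p).2.1)
    fun p => (key p).1.2.inter_of_isOpen_left (key p).2.2 (key p).1.1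
  refine ⟨_, h0.1.inter hop, h0.2.inter_of_isOpen_left hde h0.1, fun γ lam h => ?_⟩
  refine ker_mulVecLin_Rreg hτ h.1 fun i j hij => ?_
  simpa [d, fst] using Set.mem_iInter.1 h.2 ⟨(i, j), hij⟩

end EllipticQG
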